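/- arXiv:1401.2022 — 2 statements merged into one kernel-verified Lean document; each statement's English description precedes it below -/
import Mathlib

section
/- There exists a candelabra quadruple system CQS(36^5 : 12), i.e., one with five groups each of size 36 and stem size 12. -/
/-- A candelabra quadruple system on point set `Fin n` with stem `S` and
groups `G i` (`i : Fin m`): the groups partition the complement of the stem,
blocks are 4-element subsets, every 3-element subset `t` with
`|t ∩ (S ∪ G i)| < 3` for all `i` is contained in exactly one block, and no
3-element subset of any `S ∪ G i` is contained in a block. -/
def IsCQS {n m : ℕ} (S : Finset (Fin n)) (G : Fin m → Finset (Fin n))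
    (A : Finset (Finset (Fin n))) : Prop :=
  (∀ i, (G i).Nonempty) ∧
  (∀ i, Disjoint S (G i)) ∧
  (Pairwise fun i j => Disjoint (G i) (G j)) ∧
  (∀ x : Fin n, x ∉ S → ∃ i, x ∈ G i) ∧
  (∀ b ∈ A, b.card = 4) ∧
  (∀ t : Finset (Fin n), t.card = 3 → (∀ i, (t ∩ (S ∪ G i)).card < 3) →
    ∃! b, b ∈ A ∧ t ⊆ b) ∧
  (∀ t : Finset (Fin n), t.card = 3 → (∃ i, t ⊆ S ∪ G i) → ∀ b ∈ A, ¬ t ⊆ b)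

/-- The triple `p, q, r` consists of distinct points, not all in the same `V i`. -/
def IsTransversal {n m : ℕ} (V : Fin m → Finset (Fin n)) (p q r : Fin n) : Prop :=
  p ≠ q ∧ q ≠ r ∧ p ≠ r ∧ ∀ i, ¬(p ∈ V i ∧ q ∈ V i ∧ r ∈ V i)

/-- `{p, q, r, s}` is the block obtained by completing the transversal triple `p, q, r`. -/
def Completes {n m : ℕ} (V : Fin m → Finset (Fin n)) (f : Fin n → Fin n → Fin n → Fin n)
    (p q r s : Fin n) : Prop :=
  IsTransversal V p q r ∧ f p q r = s

open Classical in
/-- All blocks obtained by completing transversal triples. -/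
noncomputable def completionBlocks {n m : ℕ} (V : Fin m → Finset (Fin n))
    (f : Fin n → Fin n → Fin n → Fin n) : Finset (Finset (Fin n)) :=
  Finset.univ.filter fun b => ∃ p q r s, Completes V f p q r s ∧ b = {p, q, r, s}

theorem mem_completionBlocks {n m : ℕ} {V : Fin m → Finset (Fin n)}
    {f : Fin n → Fin n → Fin n → Fin n} {b : Finset (Fin n)} :
    b ∈ completionBlocks V f ↔ ∃ p q r s, Completes V f p q r s ∧ b = {p, q, r, s} := by
  classical
  simp [completionBlocks]

section Completion

variable {n m : ℕ} {V : Fin m → Finset (Fin n)} {f : Fin n → Fin n → Fin n → Fin n}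

theorem IsTransversal.swap_left {p q r : Fin n} (h : IsTransversal V p q r) :
    IsTransversal V q p r :=
  ⟨h.1.symm, h.2.2.1, h.2.1, fun i hi => h.2.2.2 i ⟨hi.2.1, hi.1, hi.2.2⟩⟩

theorem IsTransversal.swap_right {p q r : Fin n} (h : IsTransversal V p q r) :
    IsTransversal V p r q :=
  ⟨h.2.2.1, h.2.1.symm, h.1, fun i hi => h.2.2.2 i ⟨hi.1, hi.2.2, hi.2.1⟩⟩

theorem exists_completes_of_mem
    (h₁ : ∀ p q r s, Completes V f p q r s → Completes V f q p r s)
    (h₂ : ∀ p q r s, Completes V f p q r s → Completes V f p r q s)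
    (h₃ : ∀ p q r s, Completes V f p q r s → Completes V f p q s r)
    {a b c d p q r : Fin n} (h : Completes V f a b c d)
    (hpq : p ≠ q) (hqr : q ≠ r) (hpr : p ≠ r)
    (hp : p ∈ ({a, b, c, d} : Finset (Fin n))) (hq : q ∈ ({a, b, c, d} : Finset (Fin n)))
    (hr : r ∈ ({a, b, c, d} : Finset (Fin n))) :
    ∃ s, Completes V f p q r s ∧ ({p, q, r, s} : Finset (Fin n)) = {a, b, c, d} := by
  -- move `p` to the first position, then `q` to the second, then `r` to the third
  obtain ⟨b, c, d, h, e⟩ : ∃ b' c' d', Completes V f p b' c' d' ∧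
      ({p, b', c', d'} : Finset (Fin n)) = {a, b, c, d} := by
    simp only [Finset.mem_insert, Finset.mem_singleton] at hp
    rcases hp with rfl | rfl | rfl | rfl
    · exact ⟨_, _, _, h, rfl⟩
    · exact ⟨_, _, _, h₁ _ _ _ _ h, by ext; simp; tauto⟩
    · exact ⟨_, _, _, h₁ _ _ _ _ (h₂ _ _ _ _ h), by ext; simp; tauto⟩
    · exact ⟨_, _, _, h₁ _ _ _ _ (h₂ _ _ _ _ (h₃ _ _ _ _ h)), by ext; simp; tauto⟩
  rw [← e] at hq hr ⊢
  obtain ⟨c, d, h, e⟩ : ∃ c' d', Completes V f p q c' d' ∧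
      ({p, q, c', d'} : Finset (Fin n)) = {p, b, c, d} := by
    simp only [Finset.mem_insert, Finset.mem_singleton] at hq
    rcases hq with rfl | rfl | rfl | rfl
    · exact absurd rfl hpq
    · exact ⟨_, _, h, rfl⟩
    · exact ⟨_, _, h₂ _ _ _ _ h, by ext; simp; tauto⟩
    · exact ⟨_, _, h₂ _ _ _ _ (h₃ _ _ _ _ h), by ext; simp; tauto⟩
  rw [← e] at hr ⊢
  simp only [Finset.mem_insert, Finset.mem_singleton] at hr
  rcases hr with rfl | rfl | rfl | rfl
  · exact absurd rfl hpr
  · exact absurd rfl hqr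
  · exact ⟨_, h, rfl⟩
  · exact ⟨_, h₃ _ _ _ _ h, by ext; simp; tauto⟩

/-- A completion function on transversal triples that is symmetric and involutive gives a
candelabra quadruple system. -/
theorem isCQS_completionBlocks {S : Finset (Fin n)} {G : Fin m → Finset (Fin n)}
    (hne : ∀ i, (G i).Nonempty) (hS : ∀ i, Disjoint S (G i))
    (hG : Pairwise fun i j => Disjoint (G i) (G j)) (hcover : ∀ x, x ∉ S → ∃ i, x ∈ G i)
    (hV : ∀ i, S ∪ G i = V i)
    (hleft : ∀ p q r, IsTransversal V p q r → f q p r = f p q r)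
    (hright : ∀ p q r, IsTransversal V p q r → f p r q = f p q r)
    (htrans : ∀ p q r, IsTransversal V p q r → IsTransversal V p q (f p q r))
    (hinv : ∀ p q r, IsTransversal V p q r → f p q (f p q r) = r) :
    IsCQS S G (completionBlocks V f) := by
  have h₁ : ∀ p q r s, Completes V f p q r s → Completes V f q p r s :=
    fun p q r s h => ⟨h.1.swap_left, (hleft _ _ _ h.1).trans h.2⟩
  have h₂ : ∀ p q r s, Completes V f p q r s → Completes V f p r q s :=
    fun p q r s h => ⟨h.1.swap_right, (hright _ _ _ h.1).trans h.2⟩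
  have h₃ : ∀ p q r s, Completes V f p q r s → Completes V f p q s r := by
    rintro p q r _ ⟨h, rfl⟩
    exact ⟨htrans _ _ _ h, hinv _ _ _ h⟩
  refine ⟨hne, hS, hG, hcover, ?_, ?_, ?_⟩
  · intro b hb
    obtain ⟨p, q, r, s, h, rfl⟩ := mem_completionBlocks.1 hb
    have h' := h₃ _ _ _ _ h
    have h'' := (h₃ _ _ _ _ (h₂ _ _ _ _ h)).1
    exact Finset.card_eq_succ.2
      ⟨p, {q, r, s}, by
        simp only [Finset.mem_insert, Finset.mem_singleton, not_or]
        exact ⟨h.1.1, h.1.2.2.1, h'.1.2.2.1⟩, rfl,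
        Finset.card_eq_three.2 ⟨q, r, s, h.1.2.1, h'.1.2.1, h''.2.1, rfl⟩⟩
  · intro t ht hti
    obtain ⟨p, q, r, hpq, hpr, hqr, rfl⟩ := Finset.card_eq_three.1 ht
    have hT : IsTransversal V p q r := by
      refine ⟨hpq, hqr, hpr, fun i hi => (hti i).ne ?_⟩
      rw [Finset.inter_eq_left.2, ht]
      rw [hV]
      simp [Finset.insert_subset_iff, hi]
    refine ⟨{p, q, r, f p q r}, ⟨mem_completionBlocks.2
      ⟨p, q, r, _, ⟨hT, rfl⟩, rfl⟩, ?_⟩, ?_⟩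
    · intro x; simp; tauto
    · rintro b ⟨hb, hsub⟩
      obtain ⟨a, b, c, d, h, rfl⟩ := mem_completionBlocks.1 hb
      obtain ⟨s, hs, e⟩ := exists_completes_of_mem h₁ h₂ h₃ h hpq hqr hpr
        (hsub (by simp)) (hsub (by simp)) (hsub (by simp))
      rw [← e, ← hs.2]
  · rintro t ht ⟨i, hi⟩ b hb hsub
    obtain ⟨p, q, r, hpq, hpr, hqr, rfl⟩ := Finset.card_eq_three.1 ht
    obtain ⟨a, b, c, d, h, rfl⟩ := mem_completionBlocks.1 hb
    obtain ⟨s, hs, -⟩ := exists_completes_of_mem h₁ h₂ h₃ h hpq hqr hpr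
      (hsub (by simp)) (hsub (by simp)) (hsub (by simp))
    rw [hV] at hi
    exact hs.1.2.2.2 i ⟨hi (by simp), hi (by simp), hi (by simp)⟩

end Completion

/-! ### The spread and the one-factorization

Points of `Fin 192` are pairs of a vector of `𝔽₂⁵`, encoded in binary as an element of `Fin 32`,
and an element of `Fin 6`. -/

/-- The five lines through the origin of `𝔽₄²`, written in binary: a spread of `𝔽₂⁴`. -/
def spreadLine : Fin 5 → List ℕ :=
  ![[0, 1, 2, 3], [0, 4, 8, 12], [0, 5, 10, 15], [0, 6, 11, 13], [0, 7, 9, 14]]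

/-- The preimages in `𝔽₂⁵` of the lines of the spread. -/
def InSubspace (i : Fin 5) (u : Fin 32) : Prop := u.val / 2 ∈ spreadLine i

instance (i : Fin 5) : DecidablePred (InSubspace i) :=
  fun u => inferInstanceAs (Decidable (u.val / 2 ∈ spreadLine i))

/-- The color of an edge in a one-factorization of the complete graph on `Fin 6`. -/
def edgeColor (x y : Fin 6) : ℕ :=
  if x = 5 then 2 * y.val % 5 else if y = 5 then 2 * x.val % 5 else (x.val + y.val) % 5

/-- The other end of the edge at `z` that has the same color as the edge `x y`. -/
def mate (x y z : Fin 6) : Fin 6 :=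
  ((List.finRange 6).find? fun w => decide (w ≠ z ∧ edgeColor z w = edgeColor x y)).getD 0

theorem mate_comm : ∀ x y z, mate y x z = mate x y z := by decide

theorem mate_ne : ∀ x y z, x ≠ y → mate x y z ≠ z := by decide

theorem mate_mate : ∀ x y z, x ≠ y → mate x y (mate x y z) = z := by decide

theorem mate_mate_right : ∀ x y z, y ≠ z → mate x (mate y z x) y = z := by decide

theorem fin32_xor_comm (u w : Fin 32) : u ^^^ w = w ^^^ u := by
  revert u w; decide +kernel

theorem fin32_xor_assoc (u v w : Fin 32) : u ^^^ v ^^^ w = u ^^^ (v ^^^ w) := by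
  revert u v w; decide +kernel

theorem fin32_xor_xor_cancel (u w : Fin 32) : u ^^^ (u ^^^ w) = w := by
  revert u w; decide +kernel

theorem fin32_eq_xor_iff (u w : Fin 32) : w = u ^^^ w ↔ u = 0 := by
  revert u w; decide +kernel

theorem fin32_xor_eq_zero_iff (u w : Fin 32) : u ^^^ w = 0 ↔ u = w := by
  revert u w; decide +kernel

theorem eq_xor_xor_right_iff (u v w : Fin 32) : w = u ^^^ v ^^^ w ↔ u = v := by
  rw [fin32_eq_xor_iff, fin32_xor_eq_zero_iff]

theorem eq_xor_xor_left_iff (u v w : Fin 32) : u = u ^^^ v ^^^ w ↔ v = w := by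
  rw [fin32_xor_assoc, fin32_xor_comm, eq_xor_xor_right_iff]

theorem eq_xor_xor_middle_iff (u v w : Fin 32) : v = u ^^^ v ^^^ w ↔ u = w := by
  rw [fin32_xor_comm u, eq_xor_xor_left_iff]

theorem xor_xor_xor_xor_cancel (u v w : Fin 32) : u ^^^ v ^^^ (u ^^^ v ^^^ w) = w :=
  fin32_xor_xor_cancel _ _

theorem InSubspace.xor : ∀ i u w, InSubspace i u → InSubspace i w → InSubspace i (u ^^^ w) := by
  decide +kernel

/-- The `Fin 6`-coordinate of the fourth point of a block. -/
def completionWeight (p q r : Fin 32 × Fin 6) : Fin 6 :=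
  if p.1 = q.1 then mate p.2 q.2 r.2
  else if q.1 = r.1 then mate q.2 r.2 p.2
  else if p.1 = r.1 then mate p.2 r.2 q.2
  else -(p.2 + q.2 + r.2)

/-- The fourth point of a block, in coordinates. -/
def completion (p q r : Fin 32 × Fin 6) : Fin 32 × Fin 6 :=
  (p.1 ^^^ q.1 ^^^ r.1, completionWeight p q r)

/-- Coordinates on `Fin 192`. -/
def coords : Fin 192 ≃ Fin 32 × Fin 6 := (finProdFinEquiv (m := 32) (n := 6)).symm

theorem completion_swap_left (p q r : Fin 32 × Fin 6) :
    completion q p r = completion p q r := by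
  ext1
  · simp only [completion, fin32_xor_comm p.1 q.1]
  · simp only [completion, completionWeight, mate_comm p.2 q.2, add_comm p.2 q.2]
    grind

theorem completion_swap_right (p q r : Fin 32 × Fin 6) (h : ¬(p.1 = q.1 ∧ q.1 = r.1)) :
    completion p r q = completion p q r := by
  ext1
  · simp only [completion, fin32_xor_assoc, fin32_xor_comm r.1 q.1]
  · simp only [completion, completionWeight, mate_comm q.2 r.2, add_right_comm p.2 q.2 r.2]
    grind

theorem ne_completion_left {p q r : Fin 32 × Fin 6} (hqr : q ≠ r)
    (h : ¬(p.1 = q.1 ∧ q.1 = r.1)) : p ≠ completion p q r := by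
  intro e
  have e₁ : q.1 = r.1 := (eq_xor_xor_left_iff _ _ _).1 (congrArg Prod.fst e)
  have e₂ : p.2 = completionWeight p q r := congrArg Prod.snd e
  have hpq : p.1 ≠ q.1 := fun h' => h ⟨h', e₁⟩
  rw [completionWeight, if_neg hpq, if_pos e₁] at e₂
  exact mate_ne _ _ _ (fun h' => hqr (Prod.ext e₁ h')) e₂.symm

theorem completion_completion {p q r : Fin 32 × Fin 6} (hpq : p ≠ q) (hqr : q ≠ r)
    (hpr : p ≠ r) : completion p q (completion p q r) = r := by
  have hpq' : p.1 = q.1 → p.2 ≠ q.2 := fun e e' => hpq (Prod.ext e e')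
  have hqr' : q.1 = r.1 → q.2 ≠ r.2 := fun e e' => hqr (Prod.ext e e')
  have hpr' : p.1 = r.1 → p.2 ≠ r.2 := fun e e' => hpr (Prod.ext e e')
  ext1
  · exact xor_xor_xor_xor_cancel _ _ _
  · simp only [completion, completionWeight, eq_xor_xor_left_iff, eq_xor_xor_middle_iff]
    by_cases e₁ : p.1 = q.1
    · simp only [if_pos e₁]
      exact mate_mate _ _ _ (hpq' e₁)
    · by_cases e₂ : q.1 = r.1
      · have e₃ : p.1 ≠ r.1 := fun e => e₁ (e.trans e₂.symm)
        simp only [if_neg e₁, if_pos e₂, if_neg e₃]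
        exact mate_mate_right _ _ _ (hqr' e₂)
      · by_cases e₃ : p.1 = r.1
        · simp only [if_neg e₁, if_neg e₂, if_pos e₃]
          exact mate_mate_right _ _ _ (hpr' e₃)
        · simp only [if_neg e₁, if_neg e₂, if_neg e₃]
          abel

/-- The completion function on `Fin 192`. -/
def pointCompletion (p q r : Fin 192) : Fin 192 :=
  coords.symm (completion (coords p) (coords q) (coords r))

/-- The points of `Fin 192` lying over the `i`-th subspace. -/
def subspacePoints (i : Fin 5) : Finset (Fin 192) :=
  Finset.univ.filter fun p => InSubspace i (coords p).1

/-- The stem: the points lying over the intersection of the subspaces. -/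
def stemPoints : Finset (Fin 192) := Finset.univ.filter fun p => p.val < 12

/-- The groups. -/
def groupPoints (i : Fin 5) : Finset (Fin 192) := subspacePoints i \ stemPoints

theorem stemPoints_subset : ∀ i, stemPoints ⊆ subspacePoints i := by decide +kernel

theorem card_groupPoints : ∀ i, (groupPoints i).card = 36 := by decide +kernel

theorem pairwise_disjoint_groupPoints :
    Pairwise fun i j => Disjoint (groupPoints i) (groupPoints j) := by
  unfold Pairwise; decide +kernel

theorem exists_mem_groupPoints : ∀ x, x ∉ stemPoints → ∃ i, x ∈ groupPoints i := by
  decide +kernel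

theorem exists_inSubspace : ∀ u, ∃ i, InSubspace i u := by decide +kernel

theorem pointCompletion_swap_left (p q r : Fin 192) :
    pointCompletion q p r = pointCompletion p q r :=
  congrArg coords.symm (completion_swap_left _ _ _)

namespace IsTransversal

variable {p q r : Fin 192}

theorem not_coords_fst_eq (h : IsTransversal subspacePoints p q r) :
    ¬((coords p).1 = (coords q).1 ∧ (coords q).1 = (coords r).1) := by
  rintro ⟨e₁, e₂⟩
  obtain ⟨i, hi⟩ := exists_inSubspace (coords p).1
  refine h.2.2.2 i ⟨?_, ?_, ?_⟩ <;> simp only [subspacePoints, Finset.mem_filter,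
    Finset.mem_univ, true_and, ← e₂, ← e₁, hi]

theorem pointCompletion_swap_right (h : IsTransversal subspacePoints p q r) :
    pointCompletion p r q = pointCompletion p q r :=
  congrArg coords.symm (completion_swap_right _ _ _ h.not_coords_fst_eq)

theorem ne_pointCompletion (h : IsTransversal subspacePoints p q r) :
    p ≠ pointCompletion p q r := by
  intro e
  exact ne_completion_left (coords.injective.ne h.2.1) h.not_coords_fst_eq
    (coords.eq_symm_apply.1 e)

theorem pointCompletion_right (h : IsTransversal subspacePoints p q r) :
    IsTransversal subspacePoints p q (pointCompletion p q r) := by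
  refine ⟨h.1, ?_, h.ne_pointCompletion, ?_⟩
  · rw [← pointCompletion_swap_left]
    exact h.swap_left.ne_pointCompletion
  · rintro i ⟨hp, hq, hs⟩
    refine h.2.2.2 i ⟨hp, hq, ?_⟩
    simp only [subspacePoints, Finset.mem_filter, Finset.mem_univ, true_and, pointCompletion,
      Equiv.apply_symm_apply, completion] at hp hq hs ⊢
    rw [← xor_xor_xor_xor_cancel (coords p).1 (coords q).1 (coords r).1]
    exact (hp.xor _ _ _ hq).xor _ _ _ hs

theorem pointCompletion_pointCompletion (h : IsTransversal subspacePoints p q r) :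
    pointCompletion p q (pointCompletion p q r) = r := by
  rw [pointCompletion, coords.symm_apply_eq, pointCompletion, coords.apply_symm_apply]
  exact completion_completion (coords.injective.ne h.1) (coords.injective.ne h.2.1)
    (coords.injective.ne h.2.2.1)

end IsTransversal

/-- There exists a CQS(36^5 : 12): five groups of size 36 and stem size 12
(on 5·36 + 12 = 192 points). -/
theorem exists_CQS_36_5_12 :
    ∃ (S : Finset (Fin 192)) (G : Fin 5 → Finset (Fin 192))
      (A : Finset (Finset (Fin 192))),
      IsCQS S G A ∧ S.card = 12 ∧ ∀ i, (G i).card = 36 := by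
  refine ⟨stemPoints, groupPoints, completionBlocks subspacePoints pointCompletion,
    isCQS_completionBlocks ?_ ?_ pairwise_disjoint_groupPoints exists_mem_groupPoints ?_ ?_ ?_
      ?_ ?_, by decide +kernel, card_groupPoints⟩
  · intro i
    rw [← Finset.card_pos, card_groupPoints]
    norm_num
  · exact fun i => Finset.disjoint_sdiff
  · exact fun i => Finset.union_sdiff_of_subset (stemPoints_subset i)
  · exact fun p q r _ => pointCompletion_swap_left p q r
  · exact fun p q r h => h.pointCompletion_swap_right
  · exact fun p q r h => h.pointCompletion_right
  · exact fun p q r h => h.pointCompletion_pointCompletion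
end

section
/- There exists a candelabra quadruple system CQS(24^3 18^1 : 6), i.e., one with three groups of size 24, one group of size 18, and stem size 6. -/
namespace TripleDesign

open Finset

/-- Every triple with property `T` lies in exactly one block of `A`, every other triple lies in no
block, and all block sizes belong to `K`. -/
structure IsDesign {α : Type*} (K : Set ℕ) (T : Finset α → Prop) (A : Set (Finset α)) : Prop where
  card_mem : ∀ b ∈ A, #b ∈ K
  existsUnique : ∀ t, #t = 3 → T t → ∃! b, b ∈ A ∧ t ⊆ b
  not_subset : ∀ t, #t = 3 → ¬ T t → ∀ b ∈ A, ¬ t ⊆ b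

theorem IsDesign.congr {α : Type*} {K : Set ℕ} {T T' : Finset α → Prop} {A : Set (Finset α)}
    (h : IsDesign K T A) (hT : ∀ t, #t = 3 → (T t ↔ T' t)) : IsDesign K T' A :=
  ⟨h.card_mem, fun t ht h' => h.existsUnique t ht ((hT t ht).2 h'),
    fun t ht h' => h.not_subset t ht (mt (hT t ht).1 h')⟩

theorem IsDesign.map {α β : Type*} {K : Set ℕ} {T : Finset α → Prop} {A : Set (Finset α)}
    (h : IsDesign K T A) (φ : α ↪ β) :
    IsDesign K (fun t => ∃ s, T s ∧ s.map φ = t) (Finset.map φ '' A) where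
  card_mem := by
    rintro _ ⟨b, hb, rfl⟩
    simpa using h.card_mem b hb
  existsUnique := by
    rintro _ ht ⟨s, hs, rfl⟩
    obtain ⟨b, ⟨hb, hsb⟩, hu⟩ := h.existsUnique s (by simpa using ht) hs
    refine ⟨b.map φ, ⟨⟨b, hb, rfl⟩, map_subset_map.2 hsb⟩, ?_⟩
    rintro _ ⟨⟨c, hc, rfl⟩, hsc⟩
    rw [hu c ⟨hc, map_subset_map.1 hsc⟩]
  not_subset := by
    rintro t ht hT _ ⟨b, hb, rfl⟩ htb
    obtain ⟨s, hsb, rfl⟩ := subset_map_iff.1 htb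
    exact h.not_subset s (by simpa using ht) (fun hs => hT ⟨s, hs, rfl⟩) b hb hsb

theorem IsDesign.iUnion {α ι : Type*} {K : Set ℕ} {T : Finset α → Prop}
    {T' : ι → Finset α → Prop} {A : ι → Set (Finset α)} (h : ∀ i, IsDesign K (T' i) (A i))
    (hT : ∀ t, #t = 3 → T t → ∃! i, T' i t) (hT' : ∀ i t, #t = 3 → T' i t → T t) :
    IsDesign K T (⋃ i, A i) where
  card_mem := by
    intro b hb
    obtain ⟨i, hi⟩ := Set.mem_iUnion.1 hb
    exact (h i).card_mem b hi
  existsUnique := by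
    intro t ht htT
    obtain ⟨i, hi, hu⟩ := hT t ht htT
    obtain ⟨b, ⟨hb, htb⟩, hub⟩ := (h i).existsUnique t ht hi
    refine ⟨b, ⟨Set.mem_iUnion.2 ⟨i, hb⟩, htb⟩, ?_⟩
    rintro c ⟨hc, htc⟩
    obtain ⟨j, hj⟩ := Set.mem_iUnion.1 hc
    obtain rfl : j = i := hu j (by_contra fun hn => (h j).not_subset t ht hn c hj htc)
    exact hub c ⟨hj, htc⟩
  not_subset := by
    intro t ht htT b hb
    obtain ⟨i, hi⟩ := Set.mem_iUnion.1 hb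
    exact (h i).not_subset t ht (fun h' => htT (hT' i t ht h')) b hi

/-- The bit of `m` at position `i`; unlike `Nat.testBit` it unfolds directly to primitive operations
on literals. -/
def hasBit (m i : ℕ) : Bool := Nat.beq (Nat.land (Nat.shiftRight m i) 1) 1

/-- The subset of `Fin n` with bit mask `m`. -/
def block (n m : ℕ) : Finset (Fin n) := {x | hasBit m x}

theorem exists_eq_insert_of_card_eq_three {α : Type*} [LinearOrder α] {t : Finset α}
    (ht : #t = 3) : ∃ x, ∃ y < x, ∃ z < y, t = {x, y, z} := by
  have h := ht
  refine ⟨t.orderEmbOfFin h 2, t.orderEmbOfFin h 1, by simp, t.orderEmbOfFin h 0, by simp, ?_⟩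
  ext a
  have : a ∈ t ↔ a ∈ Set.range (t.orderEmbOfFin h) := by simp
  rw [this, Set.mem_range, Fin.exists_fin_succ, Fin.exists_fin_two]
  simp only [mem_insert, mem_singleton, eq_comm (a := a)]
  tauto

theorem isDesign_of_masks {n : ℕ} {K : Set ℕ} {T : Finset (Fin n) → Prop} [DecidablePred T]
    {L : List ℕ} (hK : ∀ m ∈ L, #(block n m) ∈ K)
    (h : ∀ x y : Fin n, y < x → ∀ z < y,
      ((L.filter (hasBit · x)).filter (hasBit · y)).countP (hasBit · z) =
        if T {x, y, z} then 1 else 0) :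
    IsDesign K T {b | ∃ m ∈ L, block n m = b} := by
  have key : ∀ t : Finset (Fin n), #t = 3 →
      (L.filter (fun m => t ⊆ block n m)).length = if T t then 1 else 0 := by
    intro t ht
    obtain ⟨x, y, hy, z, hz, rfl⟩ := exists_eq_insert_of_card_eq_three ht
    rw [← h x y hy z hz, List.countP_eq_length_filter, List.filter_filter, List.filter_filter]
    congr 2
    funext m
    simp only [insert_subset_iff, singleton_subset_iff, block, mem_filter, mem_univ, true_and,
      Bool.decide_and, Bool.decide_eq_true]
    cases hasBit m x <;> cases hasBit m y <;> cases hasBit m z <;> rfl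
  refine ⟨?_, fun t ht hT => ?_, fun t ht hT => ?_⟩
  · rintro _ ⟨m, hm, rfl⟩
    exact hK m hm
  · have := key t ht
    rw [if_pos hT, List.length_eq_one_iff] at this
    obtain ⟨m, hm⟩ := this
    have hmem : ∀ m', m' ∈ L ∧ t ⊆ block n m' ↔ m' = m := by
      intro m'
      simpa using congrArg (m' ∈ ·) hm
    obtain ⟨hL, hs⟩ := (hmem m).2 rfl
    refine ⟨block n m, ⟨⟨m, hL, rfl⟩, hs⟩, ?_⟩
    rintro _ ⟨⟨m', hm', rfl⟩, hs'⟩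
    rw [(hmem m').1 ⟨hm', hs'⟩]
  · have := key t ht
    rw [if_neg hT, List.length_eq_zero_iff, List.filter_eq_nil_iff] at this
    rintro _ ⟨m, hm, rfl⟩ hs
    exact this m hm (by simpa using hs)

/-- The bit mask of a list of numbers. -/
def mask (b : List ℕ) : ℕ := (b.map (2 ^ ·)).sum

/-- The bit masks of the first `r` translates under `σ` of the given blocks. -/
def orbitMasks (σ : ℕ → ℕ) (r : ℕ) (B : List (List ℕ)) : List ℕ :=
  B.flatMap fun b => (List.iterate (List.map σ) b r).map mask

/-- A permutation of the codes `6 * i + w` with `i < k` and `w < 6`, cyclic on the `i`. -/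
def transversalShift (k x : ℕ) : ℕ := 6 * ((x / 6 + 1) % k) + (x + 2) % 6

/-- A permutation of the codes `6 * i + w` with `i < k` and `w < 6` which rotates the fibre over
`i = 0` and permutes the other fibres cyclically. -/
def candelabraShift (k x : ℕ) : ℕ :=
  if x < 6 then (x + 1) % 6 else if x < 6 * (k - 1) then x + 6 else 6 + (x + 1) % 6

/-- The blocks, as bit masks on `{0, …, 15}`, of a design of type `4³ 3¹` with stem `{0}`: the
inversive plane of order four with one point and the circles of one tangent pencil removed. -/
def planeMasks : List ℕ :=
  [[0, 1, 5, 10, 13], [0, 1, 6, 12, 14], [0, 1, 7, 11], [0, 1, 8, 9, 15], [0, 2, 5, 11, 15],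
    [0, 2, 6, 9], [0, 2, 7, 10, 14], [0, 2, 8, 12, 13], [0, 3, 5, 9, 14], [0, 3, 6, 11, 13],
    [0, 3, 7, 12, 15], [0, 3, 8, 10], [0, 4, 5, 12], [0, 4, 6, 10, 15], [0, 4, 7, 9, 13],
    [0, 4, 8, 11, 14], [1, 2, 5, 8], [1, 2, 6, 7, 13], [1, 2, 9, 11, 14], [1, 2, 10, 12, 15],
    [1, 3, 5, 11, 12], [1, 3, 6, 15], [1, 3, 7, 9, 10], [1, 3, 8, 13, 14], [1, 4, 5, 6, 9],
    [1, 4, 7, 8, 12], [1, 4, 10, 14], [1, 4, 11, 13, 15], [1, 5, 7, 14, 15], [1, 6, 8, 10, 11],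
    [1, 9, 12, 13], [2, 3, 5, 6, 10], [2, 3, 7, 8, 11], [2, 3, 9, 13, 15], [2, 3, 12, 14],
    [2, 4, 5, 13, 14], [2, 4, 6, 11, 12], [2, 4, 7, 15], [2, 4, 8, 9, 10], [2, 5, 7, 9, 12],
    [2, 6, 8, 14, 15], [2, 10, 11, 13], [3, 4, 5, 8, 15], [3, 4, 6, 7, 14], [3, 4, 9, 11],
    [3, 4, 10, 12, 13], [3, 5, 7, 13], [3, 6, 8, 9, 12], [3, 10, 11, 14, 15], [4, 5, 7, 10, 11],
    [4, 6, 8, 13], [4, 9, 12, 14, 15], [5, 6, 11, 14], [5, 6, 12, 13, 15], [5, 8, 9, 11, 13],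
    [5, 8, 10, 12, 14], [5, 9, 10, 15], [6, 7, 9, 11, 15], [6, 7, 10, 12], [6, 9, 10, 13, 14],
    [7, 8, 9, 14], [7, 8, 10, 13, 15], [7, 11, 12, 13, 14], [8, 11, 12, 15]].map mask

/-- Blocks of the H-design `H(4, 6, 4, 3)`, as bit masks. -/
def transversalMasks₄ : List ℕ :=
  orbitMasks (transversalShift 4) 12
    [[0, 6, 13, 23], [0, 6, 14, 20], [0, 6, 15, 19], [0, 6, 17, 21], [0, 7, 13, 22],
     [0, 7, 14, 21], [0, 7, 15, 20], [0, 8, 12, 22], [0, 8, 13, 19], [0, 8, 17, 23],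
     [0, 9, 14, 23], [0, 9, 17, 20], [0, 10, 15, 23], [0, 11, 14, 19], [1, 7, 15, 21],
     [1, 9, 13, 23]] ++
  orbitMasks (transversalShift 4) 3
    [[0, 6, 12, 18], [1, 7, 13, 19]] ++
  orbitMasks (transversalShift 4) 6
    [[0, 7, 12, 19], [0, 9, 12, 21], [0, 11, 12, 23]]

/-- Blocks of the H-design `H(5, 6, 4, 3)`, as bit masks. -/
def transversalMasks₅ : List ℕ :=
  orbitMasks (transversalShift 5) 15
    [[0, 6, 12, 25], [0, 6, 13, 23], [0, 6, 14, 27], [0, 6, 15, 26], [0, 6, 16, 18],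
     [0, 6, 17, 22], [0, 6, 20, 28], [0, 6, 21, 29], [0, 7, 12, 19], [0, 7, 13, 20],
     [0, 7, 14, 29], [0, 7, 15, 21], [0, 7, 16, 26], [0, 7, 22, 27], [0, 7, 23, 28],
     [0, 8, 12, 23], [0, 8, 13, 27], [0, 8, 17, 18], [0, 8, 19, 29], [0, 9, 12, 27],
     [0, 9, 13, 21], [0, 9, 14, 18], [0, 9, 15, 19], [0, 9, 17, 29], [0, 9, 22, 26],
     [0, 9, 23, 25], [0, 10, 18, 29], [0, 10, 21, 27], [0, 11, 13, 29], [0, 11, 15, 20],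
     [0, 11, 17, 25], [0, 11, 23, 27], [0, 13, 19, 25], [0, 17, 19, 27], [1, 7, 15, 19],
     [1, 7, 23, 27]]

/-- Blocks of a `CQS(6³ : 6)`, as bit masks. -/
def candelabraMasks₄ : List ℕ :=
  orbitMasks (candelabraShift 4) 18
    [[0, 6, 12, 19], [0, 6, 13, 22], [0, 6, 14, 23], [0, 6, 15, 20], [0, 6, 16, 21],
     [0, 6, 17, 18], [0, 7, 12, 22], [0, 7, 13, 19], [0, 7, 14, 20], [0, 7, 15, 23],
     [0, 7, 16, 18], [0, 7, 17, 21], [6, 7, 12, 13], [6, 7, 14, 15], [6, 7, 16, 17],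
     [6, 8, 12, 16], [6, 8, 13, 15], [6, 8, 14, 17], [6, 8, 20, 23]] ++
  orbitMasks (candelabraShift 4) 9
    [[6, 9, 13, 16]]

/-- Blocks of a `CQS(6⁴ : 6)`, as bit masks. -/
def candelabraMasks₅ : List ℕ :=
  orbitMasks (candelabraShift 5) 24
    [[0, 6, 12, 23], [0, 6, 13, 19], [0, 6, 14, 21], [0, 6, 15, 26], [0, 6, 16, 25],
     [0, 6, 17, 28], [0, 6, 18, 27], [0, 6, 20, 24], [0, 7, 12, 27], [0, 7, 13, 24],
     [0, 7, 14, 29], [0, 7, 15, 18], [0, 7, 16, 20], [0, 7, 21, 28], [0, 8, 12, 25],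
     [0, 8, 13, 18], [0, 8, 14, 27], [0, 8, 16, 29], [6, 7, 12, 21], [6, 7, 13, 17],
     [6, 7, 14, 24], [6, 7, 15, 16], [6, 7, 18, 29], [6, 7, 19, 23], [6, 7, 20, 22],
     [6, 7, 25, 28], [6, 8, 12, 26], [6, 8, 13, 16], [6, 8, 14, 29], [6, 8, 15, 28],
     [6, 8, 17, 27], [6, 8, 20, 23], [6, 13, 23, 25]] ++
  orbitMasks (candelabraShift 5) 6
    [[6, 9, 19, 22]] ++
  orbitMasks (candelabraShift 5) 12
    [[6, 9, 12, 15]]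

/-- The index `i` of the point with code `6 * i + w`. -/
abbrev index {k : ℕ} (x : Fin (k * 6)) : Fin k := x.divNat

/-- The triple meets three different fibres. -/
abbrev Transversal {k : ℕ} (t : Finset (Fin (k * 6))) : Prop := 3 ≤ #(t.image index)

/-- The triple is not contained in the union of the fibre over `0` and one more fibre. -/
abbrev Candelabral {k : ℕ} [NeZero k] (t : Finset (Fin (k * 6))) : Prop :=
  3 ≤ #(insert 0 (t.image index))

/-- The triple is not contained in the union of `{0}` and one of the sets `{1, …, 4}`,
`{5, …, 8}`, `{9, …, 12}`, `{13, 14, 15}`. -/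
abbrev Spread (s : Finset (Fin 16)) : Prop :=
  ∀ j < 4, ∃ x ∈ s, x ≠ 0 ∧ (x.val - 1) / 4 ≠ j

theorem isDesign_plane :
    IsDesign {k | k = 4 ∨ k = 5} Spread {b | ∃ m ∈ planeMasks, block 16 m = b} :=
  isDesign_of_masks (by simp only [Set.mem_ofPred_eq]; decide +kernel) (by decide +kernel)

theorem isDesign_transversal_four :
    IsDesign {4} (Transversal (k := 4)) {b | ∃ m ∈ transversalMasks₄, block (4 * 6) m = b} :=
  isDesign_of_masks (by simp only [Set.mem_singleton_iff]; decide +kernel) (by decide +kernel)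

theorem isDesign_transversal_five :
    IsDesign {4} (Transversal (k := 5)) {b | ∃ m ∈ transversalMasks₅, block (5 * 6) m = b} :=
  isDesign_of_masks (by simp only [Set.mem_singleton_iff]; decide +kernel) (by decide +kernel)

theorem isDesign_candelabral_four :
    IsDesign {4} (Candelabral (k := 4)) {b | ∃ m ∈ candelabraMasks₄, block (4 * 6) m = b} :=
  isDesign_of_masks (by simp only [Set.mem_singleton_iff]; decide +kernel) (by decide +kernel)

theorem isDesign_candelabral_five :
    IsDesign {4} (Candelabral (k := 5)) {b | ∃ m ∈ candelabraMasks₅, block (5 * 6) m = b} :=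
  isDesign_of_masks (by simp only [Set.mem_singleton_iff]; decide +kernel) (by decide +kernel)

/-- The embedding of fibred point sets induced by an embedding of the index sets. -/
def fibreMap {k l : ℕ} (p : Fin k ↪ Fin l) : Fin (k * 6) ↪ Fin (l * 6) :=
  finProdFinEquiv.symm.toEmbedding.trans
    ((p.prodMap (.refl (Fin 6))).trans finProdFinEquiv.toEmbedding)

theorem index_fibreMap {k l : ℕ} (p : Fin k ↪ Fin l) (x : Fin (k * 6)) :
    index (fibreMap p x) = p (index x) :=
  congrArg Prod.fst (finProdFinEquiv.symm_apply_apply (p x.divNat, x.modNat))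

theorem image_index_map {k l : ℕ} (p : Fin k ↪ Fin l) (s : Finset (Fin (k * 6))) :
    (s.map (fibreMap p)).image index = (s.image index).map p := by
  ext
  simp [index_fibreMap]

theorem exists_map_fibreMap {k l : ℕ} (p : Fin k ↪ Fin l) {t : Finset (Fin (l * 6))}
    (ht : ∀ x ∈ t, index x ∈ Set.range p) : ∃ s : Finset (Fin (k * 6)), s.map (fibreMap p) = t := by
  have : (t : Set (Fin (l * 6))) ⊆ fibreMap p '' Set.univ := by
    intro x hx
    obtain ⟨i, hi⟩ := ht x hx
    refine ⟨finProdFinEquiv (i, x.modNat), trivial, ?_⟩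
    change finProdFinEquiv (p (finProdFinEquiv.symm (finProdFinEquiv (i, x.modNat))).1,
      (finProdFinEquiv.symm (finProdFinEquiv (i, x.modNat))).2) = x
    rw [Equiv.symm_apply_apply, hi]
    exact finProdFinEquiv.apply_symm_apply x
  obtain ⟨s, -, hs⟩ := subset_set_image_iff.1 this
  exact ⟨s, by rw [map_eq_image, hs]⟩

theorem exists_isDesign_transversal {l : ℕ} {B : Finset (Fin l)} (hB : #B = 4 ∨ #B = 5) :
    ∃ A, IsDesign {4} (fun t : Finset (Fin (l * 6)) => Transversal t ∧ t.image index ⊆ B) A := by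
  obtain ⟨k, hk, A, hA⟩ : ∃ k, #B = k ∧ ∃ A, IsDesign {4} (Transversal (k := k)) A :=
    hB.elim (fun h => ⟨4, h, _, isDesign_transversal_four⟩)
      (fun h => ⟨5, h, _, isDesign_transversal_five⟩)
  let p := (B.orderEmbOfFin hk).toEmbedding
  refine ⟨_, (hA.map (fibreMap p)).congr fun t ht => ⟨?_, fun ⟨hT, htB⟩ => ?_⟩⟩
  · rintro ⟨s, hs, rfl⟩
    rw [Transversal, image_index_map, card_map]
    refine ⟨hs, fun i hi => ?_⟩
    obtain ⟨j, -, rfl⟩ := mem_map.1 hi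
    exact orderEmbOfFin_mem B hk j
  · obtain ⟨s, rfl⟩ := exists_map_fibreMap p (t := t) fun x hx => by
      simpa [p] using htB (mem_image_of_mem _ hx)
    rw [Transversal, image_index_map, card_map] at hT
    exact ⟨s, hT, rfl⟩

theorem exists_isDesign_candelabral {l : ℕ} [NeZero l] {B : Finset (Fin l)}
    (hB : #B = 4 ∨ #B = 5) (h0 : 0 ∈ B) :
    ∃ A, IsDesign {4} (fun t : Finset (Fin (l * 6)) => Candelabral t ∧ t.image index ⊆ B) A := by
  obtain ⟨k, _, hk, A, hA⟩ :
      ∃ (k : ℕ) (_ : NeZero k), #B = k ∧ ∃ A, IsDesign {4} (Candelabral (k := k)) A :=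
    hB.elim (fun h => ⟨4, inferInstance, h, _, isDesign_candelabral_four⟩)
      (fun h => ⟨5, inferInstance, h, _, isDesign_candelabral_five⟩)
  let p := (B.orderEmbOfFin hk).toEmbedding
  have hp : p 0 = 0 := by
    have h : B.min' ⟨0, h0⟩ = 0 := le_antisymm (min'_le B 0 h0) (Fin.zero_le _)
    rw [← h]
    exact orderEmbOfFin_zero hk (NeZero.pos k)
  have hcard (s : Finset (Fin (k * 6))) :
      #(insert 0 ((s.map (fibreMap p)).image index)) = #(insert 0 (s.image index)) := by
    rw [image_index_map, ← card_map p, map_insert, hp]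
  refine ⟨_, (hA.map (fibreMap p)).congr fun t ht => ⟨?_, fun ⟨hT, htB⟩ => ?_⟩⟩
  · rintro ⟨s, hs, rfl⟩
    rw [Candelabral, hcard]
    refine ⟨hs, fun i hi => ?_⟩
    rw [image_index_map] at hi
    obtain ⟨j, -, rfl⟩ := mem_map.1 hi
    exact orderEmbOfFin_mem B hk j
  · obtain ⟨s, rfl⟩ := exists_map_fibreMap p (t := t) fun x hx => by
      simpa [p] using htB (mem_image_of_mem _ hx)
    rw [Candelabral, hcard] at hT
    exact ⟨s, hT, rfl⟩

/-- The index set of a triple, completed by `0` when it has fewer than three elements. -/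
def support {l : ℕ} [NeZero l] (t : Finset (Fin (l * 6))) : Finset (Fin l) :=
  if 3 ≤ #(t.image index) then t.image index else insert 0 (t.image index)

theorem exists_isDesign_support {l : ℕ} [NeZero l] {B : Finset (Fin l)} (hB : #B = 4 ∨ #B = 5) :
    ∃ A, IsDesign {4} (fun t : Finset (Fin (l * 6)) => 3 ≤ #(support t) ∧ support t ⊆ B) A := by
  by_cases h0 : 0 ∈ B
  · obtain ⟨A, hA⟩ := exists_isDesign_candelabral hB h0
    refine ⟨A, hA.congr fun t _ => ?_⟩
    have := card_le_card (subset_insert 0 (t.image index))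
    unfold support
    split_ifs with h
    · exact and_congr_left fun _ => ⟨fun _ => h, fun h => h.trans this⟩
    · rw [insert_subset_iff, and_iff_right h0]
  · obtain ⟨A, hA⟩ := exists_isDesign_transversal hB
    refine ⟨A, hA.congr fun t _ => ?_⟩
    unfold support
    split_ifs with h
    · rfl
    · simp [insert_subset_iff, h0, h]

theorem card_support_le {l : ℕ} [NeZero l] {t : Finset (Fin (l * 6))} (ht : #t = 3) :
    #(support t) ≤ 3 := by
  unfold support
  split_ifs with h
  · exact card_image_le.trans ht.le
  · exact (card_insert_le _ _).trans (by lia)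

theorem spread_support {t : Finset (Fin (16 * 6))} :
    Spread (support t) ↔ Spread (t.image index) := by
  unfold support
  split_ifs <;> simp [Spread]

theorem three_le_card_of_spread {s : Finset (Fin 16)} (hs : Spread s) :
    3 ≤ #(insert 0 s) := by
  by_contra! h
  obtain ⟨x, hx, hx0, -⟩ := hs 0 (by lia)
  obtain ⟨y, hy, hy0, hyx⟩ := hs ((x.val - 1) / 4) (by lia)
  have hxy : x ≠ y := by rintro rfl; exact hyx rfl
  have : #{0, x, y} ≤ #(insert 0 s) := card_le_card (by
    intro a; simp only [mem_insert, mem_singleton]; rintro (rfl | rfl | rfl) <;> simp [hx, hy])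
  rw [card_eq_three.2 ⟨0, x, y, hx0.symm, hy0.symm, hxy, rfl⟩] at this
  lia

theorem exists_isDesign_spread :
    ∃ A, IsDesign {4} (fun t : Finset (Fin (16 * 6)) => Spread (t.image index)) A := by
  have hP := isDesign_plane
  set P : Set (Finset (Fin 16)) := {b | ∃ m ∈ planeMasks, block 16 m = b}
  choose A hA using fun B : P => exists_isDesign_support (hP.card_mem B B.2)
  refine ⟨_, IsDesign.iUnion hA (fun t ht hT => ?_) fun B t ht ⟨h3, hB⟩ => ?_⟩
  · have h3 : 3 ≤ #(support t) := by
      unfold support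
      split_ifs with h
      exacts [h, three_le_card_of_spread hT]
    obtain ⟨B, ⟨hB, hs⟩, hu⟩ := hP.existsUnique _ ((card_support_le ht).antisymm h3)
      (spread_support.2 hT)
    exact ⟨⟨B, hB⟩, ⟨h3, hs⟩, fun C hC => Subtype.ext (hu C ⟨C.2, hC.2⟩)⟩
  · by_contra hT
    exact hP.not_subset _ ((card_support_le ht).antisymm h3) (mt spread_support.1 hT) B B.2 hB

end TripleDesign

/-- There exists a CQS(24³ 18¹ : 6): three groups of size 24, one group of
size 18, and stem size 6 (on 3·24 + 18 + 6 = 96 points). -/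
theorem exists_CQS_24_3_18_1_6 :
    ∃ (S : Finset (Fin 96)) (G : Fin 4 → Finset (Fin 96))
      (A : Finset (Finset (Fin 96))),
      IsCQS S G A ∧ S.card = 6 ∧
      (G 0).card = 24 ∧ (G 1).card = 24 ∧ (G 2).card = 24 ∧ (G 3).card = 18 := by
  classical
  obtain ⟨A, hA⟩ := TripleDesign.exists_isDesign_spread
  let S : Finset (Fin 96) := {x | x.val / 6 = 0}
  let G (j : Fin 4) : Finset (Fin 96) := {x | x.val / 6 ≠ 0 ∧ (x.val / 6 - 1) / 4 = j.val}
  have hG (x : Fin 96) (j : Fin 4) :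
      x ∈ S ∪ G j ↔ ¬ (x.val / 6 ≠ 0 ∧ (x.val / 6 - 1) / 4 ≠ j.val) := by
    simp only [S, G, Finset.mem_union, Finset.mem_filter, Finset.mem_univ, true_and]
    tauto
  have hT (t : Finset (Fin 96)) :
      TripleDesign.Spread (t.image (TripleDesign.index (k := 16))) ↔ ∀ j, ¬ t ⊆ S ∪ G j := by
    have h0 (x : Fin 96) : TripleDesign.index (k := 16) x ≠ 0 ↔ x.val / 6 ≠ 0 :=
      not_congr Fin.ext_iff
    simp only [TripleDesign.Spread, Finset.exists_mem_image, h0, Finset.not_subset, hG, not_not,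
      Fin.forall_iff]
    rfl
  refine ⟨S, G, A.toFinset, ⟨?_, ?_, ?_, ?_, ?_, ?_, ?_⟩, ?_, ?_, ?_, ?_, ?_⟩
  · decide +kernel
  · decide +kernel
  · unfold Pairwise
    decide +kernel
  · decide +kernel
  · exact fun b hb => hA.card_mem b (Set.mem_toFinset.1 hb)
  · intro t ht h
    simp only [Set.mem_toFinset]
    refine hA.existsUnique t ht ((hT t).2 fun j hj => ?_)
    have := h j
    rw [Finset.inter_eq_left.2 hj] at this
    lia
  · rintro t ht ⟨j, hj⟩ b hb
    exact hA.not_subset t ht (fun h => (hT t).1 h j hj) b (Set.mem_toFinset.1 hb)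
  all_goals decide +kernel
end
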